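/- Let 1/4 < s < 1/2, 0 ≤ ε < min(2s − 1/2, 1/2), 3/4 − ε/2 < θ ≤ s + 1/2 − ε, and θ < 1 − ε. There is a constant C such that for all Schwartz functions φ, ψ on ℝ^{1+2}, the null form Q_{12}(φ,ψ) = ∂_1φ·∂_2ψ − ∂_2φ·∂_1ψ (derivatives in the two spatial variables) satisfies ‖Q_{12}(φ,ψ)‖_{H^{s,θ−1+ε}} ≤ C·‖∇φ‖_{H^{s,θ}}·‖∇ψ‖_{H^{s,θ}}, where ‖∇φ‖_{H^{s,θ}} = (‖∂_1φ‖²_{H^{s,θ}} + ‖∂_2φ‖²_{H^{s,θ}})^{1/2}. -/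

import Mathlib

noncomputable section

open MeasureTheory Real
open scoped ENNReal RealInnerProductSpace

/-- The spatial domain `ℝ²`. -/
abbrev V2 : Type := EuclideanSpace ℝ (Fin 2)

/-- Space-time Fourier transform on `ℝ^{1+2}`, convention `e^{-i(tτ + x·ξ)}`. -/
def ftST (u : ℝ × V2 → ℂ) (τ : ℝ) (ξ : V2) : ℂ :=
  ∫ p : ℝ × V2, Complex.exp (-Complex.I * ((p.1 * τ + ⟪p.2, ξ⟫ : ℝ) : ℂ)) * u p

/-- The weight `(1+|ξ|²)^{s/2} (1+||τ|-|ξ||)^θ`. -/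
def wgt (s θ τ : ℝ) (ξ : V2) : ℝ :=
  (1 + ‖ξ‖ ^ 2) ^ (s / 2) * (1 + |(|τ| - ‖ξ‖)|) ^ θ

/-- The Wave–Sobolev norm `H^{s,θ}` on `ℝ^{1+2}`. -/
def HN (s θ : ℝ) (u : ℝ × V2 → ℂ) : ℝ≥0∞ :=
  (∫⁻ q : ℝ × V2, (ENNReal.ofReal (wgt s θ q.1 q.2) * (‖ftST u q.1 q.2‖₊ : ℝ≥0∞)) ^ (2 : ℕ)) ^
    ((1 : ℝ) / 2)

/-- Time derivative `∂ₜ u`. -/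
def dtime (u : ℝ × V2 → ℂ) : ℝ × V2 → ℂ :=
  fun p => fderiv ℝ u p ((1 : ℝ), (0 : V2))

/-- The norm of `𝓗^{s,θ}`: `‖u‖_{H^{s,θ}} + ‖∂ₜu‖_{H^{s-1,θ}}`. -/
def HHN (s θ : ℝ) (u : ℝ × V2 → ℂ) : ℝ≥0∞ :=
  HN s θ u + HN (s - 1) θ (dtime u)

/-- Spatial partial derivative `∂ⱼ u`, `j = 0, 1`. -/
def pdx (j : Fin 2) (u : ℝ × V2 → ℂ) : ℝ × V2 → ℂ :=
  fun p => fderiv ℝ u p ((0 : ℝ), EuclideanSpace.single j 1)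

/-- Inverse space-time Fourier transform. -/
def iftST (F : ℝ → V2 → ℂ) (t : ℝ) (x : V2) : ℂ :=
  ((((2 * π) ^ 3)⁻¹ : ℝ) : ℂ) *
    ∫ q : ℝ × V2, Complex.exp (Complex.I * ((t * q.1 + ⟪x, q.2⟫ : ℝ) : ℂ)) * F q.1 q.2

/-- The space-time Fourier multiplier with symbol `m`. -/
def mult (m : ℝ → V2 → ℂ) (u : ℝ × V2 → ℂ) : ℝ × V2 → ℂ :=
  fun p => iftST (fun τ ξ => m τ ξ * ftST u τ ξ) p.1 p.2

/-- The null form `Q₁₂(φ,ψ) = ∂₁φ ∂₂ψ - ∂₂φ ∂₁ψ` (spatial derivatives). -/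
def Q12 (φ ψ : ℝ × V2 → ℂ) : ℝ × V2 → ℂ :=
  fun p => pdx 0 φ p * pdx 1 ψ p - pdx 1 φ p * pdx 0 ψ p

/-- `‖∇φ‖_{H^{s,θ}} = (‖∂₁φ‖²_{H^{s,θ}} + ‖∂₂φ‖²_{H^{s,θ}})^{1/2}`. -/
def gradHN (s θ : ℝ) (φ : ℝ × V2 → ℂ) : ℝ≥0∞ :=
  (HN s θ (pdx 0 φ) ^ (2 : ℕ) + HN s θ (pdx 1 φ) ^ (2 : ℕ)) ^ ((1 : ℝ) / 2)

lemma aux_core {a w m n1 n2 sn : ℝ} (ha : 0 ≤ a) (ha' : a < 1/2) (hw : 0 < w) (hm : 0 < m)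
    (h1 : m ≤ 2 * n1) (h2 : m ≤ 2 * n2) (hsn0 : 0 ≤ sn) (hsn : sn ^ 2 * m ≤ 8 * w) :
    sn * (n1 ^ (a - 1) + n2 ^ (a - 1)) * w ^ (-a) ≤ 12 * (w ^ (1/2 - a) * m ^ (a - 3/2)) := by
  have hs : sn ≤ 3 * (w ^ (1/2:ℝ) * m ^ (-(1/2):ℝ)) := by
    rw [Real.rpow_neg hm.le, ← Real.sqrt_eq_rpow, ← Real.sqrt_eq_rpow]
    have hsm : 0 < √m := Real.sqrt_pos.2 hm
    have : sn * √m ≤ 3 * √w := by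
      apply le_of_sq_le_sq _ (by positivity)
      rw [mul_pow, mul_pow, Real.sq_sqrt hm.le, Real.sq_sqrt hw.le]; linarith
    rw [← mul_assoc, ← div_eq_mul_inv, le_div_iff₀ hsm]; exact this
  have hn : ∀ n : ℝ, m ≤ 2 * n → n ^ (a - 1) ≤ 2 * m ^ (a - 1) := by
    intro n hn
    have : n ^ (a - 1) ≤ (m / 2) ^ (a - 1) :=
      Real.rpow_le_rpow_of_nonpos (by linarith) (by linarith) (by linarith)
    refine this.trans ?_
    rw [Real.div_rpow hm.le (by norm_num), div_eq_mul_inv, mul_comm, ← Real.rpow_neg (by norm_num)]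
    gcongr
    calc (2:ℝ) ^ (-(a-1)) ≤ 2 ^ (1:ℝ) := Real.rpow_le_rpow_of_exponent_le (by norm_num) (by linarith)
      _ = 2 := by norm_num
  have e1 : w ^ (1/2 - a) = w ^ (1/2:ℝ) * w ^ (-a) := by rw [← Real.rpow_add hw]; ring_nf
  have e2 : m ^ (a - 3/2) = m ^ (-(1/2):ℝ) * m ^ (a-1) := by rw [← Real.rpow_add hm]; ring_nf
  have := hn n1 h1
  have := hn n2 h2
  have p1 : 0 ≤ n1 ^ (a-1) := Real.rpow_nonneg (by linarith) _
  have p2 : 0 ≤ n2 ^ (a-1) := Real.rpow_nonneg (by linarith) _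
  rw [e1, e2]
  calc sn * (n1 ^ (a - 1) + n2 ^ (a - 1)) * w ^ (-a)
      ≤ (3 * (w ^ (1/2:ℝ) * m ^ (-(1/2):ℝ))) * (4 * m ^ (a-1)) * w ^ (-a) := by
        gcongr; linarith
    _ = _ := by ring

lemma aux_pp {R u v n1 n2 sn : ℝ} (hR : 0 < R) (hu : R < u) (hv : |v| < R)
    (h1 : 2 * n1 = u + v) (h2 : 2 * n2 = u - v)
    (h : sn ^ 2 * (2 * (n1 * n2)) ^ 2 = (u^2-R^2)*(R^2-v^2)) :
    sn ^ 2 * (u - |v|) ≤ 8 * (u - R) := by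
  have hn : 2 * (n1 * n2) = (u - |v|) * (u + |v|) / 2 := by
    have : n1 = (u+v)/2 := by linarith
    have : n2 = (u-v)/2 := by linarith
    subst n1 n2
    have := sq_abs v
    linear_combination (-1/2) * (-this)
  have h0 := abs_nonneg v
  rw [hn, ← sq_abs v] at h
  generalize |v| = z at *
  have hp : 0 < (u - z) * (u+z)^2 := by have : 0 < u - z := by linarith
                                        have : 0 < u + z := by linarith
                                        positivity
  have : sn^2 * (u-z) * ((u-z)*(u+z)^2) ≤ 8 * (u-R) * ((u-z)*(u+z)^2) := by
    have e : sn^2 * (u-z) * ((u-z)*(u+z)^2) = 4 * ((u^2-R^2)*(R^2-z^2)) := by rw [← h]; ring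
    rw [e]
    have : (u+R)*(R^2-z^2) ≤ 2 * ((u-z)*(u+z)^2) := by
      have : (u-z)*(u+z)^2 = (u^2-z^2)*(u+z) := by ring
      rw [this]
      have a1 : R^2 - z^2 ≤ u^2-z^2 := by nlinarith
      have a2 : 0 ≤ R^2-z^2 := by nlinarith
      calc _ ≤ (2*(u+z))*(u^2-z^2) := by
            have : u + R ≤ 2 * (u + z) := by linarith
            have : 0 ≤ 2 * (u + z) := by linarith
            gcongr
        _ = _ := by ring
    have := mul_le_mul_of_nonneg_left this (show 0 ≤ u - R by linarith)
    nlinarith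
  exact le_of_mul_le_mul_right this hp

lemma aux_pm {R u v n1 n2 sn : ℝ} (hR : 0 < R) (hu : R < u) (hv : |v| < R)
    (h1 : 2 * n1 = u + v) (h2 : 2 * n2 = u - v)
    (h : sn ^ 2 * (2 * (n1 * n2)) ^ 2 = (u^2-R^2)*(R^2-v^2)) :
    sn ^ 2 * (u - |v|) ≤ 8 * (R - |v|) := by
  have hn : 2 * (n1 * n2) = (u - |v|) * (u + |v|) / 2 := by
    have : n1 = (u+v)/2 := by linarith
    have : n2 = (u-v)/2 := by linarith
    subst n1 n2
    have := sq_abs v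
    linear_combination (-1/2) * (-this)
  have h0 := abs_nonneg v
  rw [hn, ← sq_abs v] at h
  generalize |v| = z at *
  have hp : 0 < (u - z) * (u+z)^2 := by have : 0 < u - z := by linarith
                                        have : 0 < u + z := by linarith
                                        positivity
  have : sn^2 * (u-z) * ((u-z)*(u+z)^2) ≤ 8 * (R-z) * ((u-z)*(u+z)^2) := by
    have e : sn^2 * (u-z) * ((u-z)*(u+z)^2) = 4 * ((u^2-R^2)*(R^2-z^2)) := by rw [← h]; ring
    rw [e]
    have : (u+R)*(u-R) * (R+z) ≤ 2 * ((u-z)*(u+z)^2) := by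
      have : (u+R)*(u-R) * (R+z) ≤ (2*(u+z))*(u-z)*(u+z) := by
        have : 0 ≤ u - R := by linarith
        have : 0 ≤ u + R := by linarith
        have : 0 ≤ u - z := by linarith
        have : 0 ≤ u + z := by linarith
        have : 0 ≤ R + z := by linarith
        have : u + R ≤ 2 * (u + z) := by linarith
        gcongr
      linarith
    have := mul_le_mul_of_nonneg_left this (show 0 ≤ R - z by linarith)
    nlinarith
  exact le_of_mul_le_mul_right this hp

lemma int_one {a w c : ℝ} (ha' : a < 1/2) (hw : 0 < w) :
    ∫⁻ t in Set.Ioi c, ENNReal.ofReal (w ^ (1/2 - a) * (t - c + w) ^ (a - 3/2))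
      ≤ ENNReal.ofReal (1 / (1/2 - a)) := by
  have h0 : -(w - c) < c := by linarith
  have hlt : a - 3/2 < -1 := by linarith
  have hi := integrableOn_add_rpow_Ioi_of_lt hlt h0
  have e : ∀ t, w ^ (1/2 - a) * (t - c + w) ^ (a - 3/2) = w ^ (1/2 - a) * (t + (w-c)) ^ (a - 3/2) := by
    intro t; ring_nf
  simp_rw [e]
  rw [← ofReal_integral_eq_lintegral_ofReal (hi.const_mul _), integral_const_mul]
  · apply ENNReal.ofReal_le_ofReal
    have : ∫ t in Set.Ioi c, (t + (w-c)) ^ (a - 3/2) = w ^ (a - 1/2) / (1/2 - a) := by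
      have := (measurePreserving_add_right volume (w-c)).setIntegral_preimage_emb
        (measurableEmbedding_addRight (w-c)) (fun t => t ^ (a-3/2)) (Set.Ioi w)
      have e' : (fun x => x + (w - c)) ⁻¹' Set.Ioi w = Set.Ioi c := by
        ext x; simp
      rw [e'] at this
      rw [this, integral_Ioi_rpow_of_lt hlt (by linarith)]
      rw [show a - 3/2+1 = -(1/2-a) by ring, neg_div_neg_eq]; ring_nf
    rw [this, ← mul_div_assoc, ← Real.rpow_add hw]
    ring_nf; simp
  · filter_upwards [ae_restrict_mem measurableSet_Ioi] with t ht
    have : 0 < t + (w - c) := by simp at ht; linarith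
    positivity
def bn1 (z : ℝ × ℝ) : ℝ := √(z.1 ^ 2 + z.2 ^ 2)
def bn2 (A B : ℝ) (z : ℝ × ℝ) : ℝ := √((A - z.1) ^ 2 + (B - z.2) ^ 2)
def bcr (A B : ℝ) (z : ℝ × ℝ) : ℝ := z.1 * (B - z.2) - z.2 * (A - z.1)
def bsn (A B : ℝ) (z : ℝ × ℝ) : ℝ := |bcr A B z| / (bn1 z * bn2 A B z)
def bmap (A B : ℝ) (z : ℝ × ℝ) : ℝ × ℝ := (bn1 z + bn2 A B z, bn1 z - bn2 A B z)

lemma bn1_sq (z : ℝ × ℝ) : bn1 z ^ 2 = z.1 ^ 2 + z.2 ^ 2 := Real.sq_sqrt (by positivity)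
lemma bn2_sq (A B : ℝ) (z : ℝ × ℝ) : bn2 A B z ^ 2 = (A - z.1) ^ 2 + (B - z.2) ^ 2 :=
  Real.sq_sqrt (by positivity)

lemma bn1_pos {A B : ℝ} {z : ℝ × ℝ} (h : bcr A B z ≠ 0) : 0 < bn1 z := by
  apply Real.sqrt_pos.2
  by_contra hn
  have h1 : z.1 = 0 := by nlinarith [sq_nonneg z.1, sq_nonneg z.2]
  have h2 : z.2 = 0 := by nlinarith [sq_nonneg z.1, sq_nonneg z.2]
  exact h (by simp [bcr, h1, h2])

lemma bn2_pos {A B : ℝ} {z : ℝ × ℝ} (h : bcr A B z ≠ 0) : 0 < bn2 A B z := by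
  apply Real.sqrt_pos.2
  by_contra hn
  have h1 : A - z.1 = 0 := by nlinarith [sq_nonneg (A - z.1), sq_nonneg (B - z.2)]
  have h2 : B - z.2 = 0 := by nlinarith [sq_nonneg (A - z.1), sq_nonneg (B - z.2)]
  exact h (by simp [bcr, h1, h2])

lemma bR_pos {A B : ℝ} {z : ℝ × ℝ} (h : bcr A B z ≠ 0) : 0 < √(A ^ 2 + B ^ 2) := by
  apply Real.sqrt_pos.2
  by_contra hn
  have h1 : A = 0 := by nlinarith [sq_nonneg A, sq_nonneg B]
  have h2 : B = 0 := by nlinarith [sq_nonneg A, sq_nonneg B]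
  exact h (by simp [bcr, h1, h2]; ring)

/-- Heron identity. -/
lemma heron (A B : ℝ) (z : ℝ × ℝ) :
    4 * bcr A B z ^ 2 = ((bmap A B z).1 ^ 2 - √(A ^ 2 + B ^ 2) ^ 2) *
      (√(A ^ 2 + B ^ 2) ^ 2 - (bmap A B z).2 ^ 2) := by
  rw [Real.sq_sqrt (by positivity)]
  have h1 := bn1_sq z
  have h2 := bn2_sq A B z
  simp only [bmap, bcr]
  have : ((bn1 z + bn2 A B z) ^ 2 - (A ^ 2 + B ^ 2)) * (A ^ 2 + B ^ 2 - (bn1 z - bn2 A B z) ^ 2)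
    = 4 * (bn1 z ^ 2) * (bn2 A B z ^ 2) - (A^2 + B^2 - bn1 z ^ 2 - bn2 A B z ^ 2) ^ 2 := by ring
  rw [this, h1, h2]; ring

lemma bsn_heron {A B : ℝ} {z : ℝ × ℝ} (h : bcr A B z ≠ 0) :
    bsn A B z ^ 2 * (2 * (bn1 z * bn2 A B z)) ^ 2 = ((bmap A B z).1 ^ 2 - √(A ^ 2 + B ^ 2) ^ 2) *
      (√(A ^ 2 + B ^ 2) ^ 2 - (bmap A B z).2 ^ 2) := by
  rw [← heron, bsn, div_pow, sq_abs]
  have := bn1_pos h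
  have := bn2_pos h
  field_simp; ring

lemma bmap_region {A B : ℝ} {z : ℝ × ℝ} (h : bcr A B z ≠ 0) :
    √(A ^ 2 + B ^ 2) < (bmap A B z).1 ∧ |(bmap A B z).2| < √(A ^ 2 + B ^ 2) := by
  have h1 := bn1_pos h
  have h2 := bn2_pos h
  have h3 := bR_pos h
  have hh := heron A B z
  have hp : 0 < 4 * bcr A B z ^ 2 := by positivity
  rw [hh] at hp
  have huv : (bmap A B z).2 ^ 2 < (bmap A B z).1 ^ 2 := by
    simp only [bmap]; nlinarith [mul_pos h1 h2]
  have hu : 0 < (bmap A B z).1 := by simp only [bmap]; positivity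
  generalize √(A ^ 2 + B ^ 2) = R at *
  rcases pos_and_pos_or_neg_and_neg_of_mul_pos hp with ⟨a, b⟩ | ⟨a, b⟩
  · exact ⟨by nlinarith, abs_lt_of_sq_lt_sq (by linarith) h3.le⟩
  · linarith

lemma bmap_inj {A B : ℝ} {z z' : ℝ × ℝ} (h : 0 < bcr A B z * bcr A B z')
    (he : bmap A B z = bmap A B z') : z = z' := by
  have hz : bcr A B z ≠ 0 := left_ne_zero_of_mul h.ne'
  have e1 : bn1 z = bn1 z' := by
    have := congrArg Prod.fst he; have := congrArg Prod.snd he; simp only [bmap] at *; linarith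
  have e2 : bn2 A B z = bn2 A B z' := by
    have := congrArg Prod.fst he; have := congrArg Prod.snd he; simp only [bmap] at *; linarith
  have c2 : bcr A B z ^ 2 = bcr A B z' ^ 2 := by
    have a1 := heron A B z
    have a2 := heron A B z'
    rw [he] at a1; linarith
  have c : bcr A B z = bcr A B z' := by
    rcases sq_eq_sq_iff_eq_or_eq_neg.1 c2 with c | c
    · exact c
    · rw [c] at h; nlinarith [sq_nonneg (bcr A B z')]
  have q1 := bn1_sq z
  have q2 := bn2_sq A B z
  rw [e1, bn1_sq] at q1
  rw [e2, bn2_sq] at q2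
  have hd : z.1 * A + z.2 * B = z'.1 * A + z'.2 * B := by linarith
  have hR : A ^ 2 + B ^ 2 ≠ 0 := (Real.sqrt_pos.1 (bR_pos hz)).ne'
  simp only [bcr] at c
  ext
  · apply mul_left_cancel₀ hR; linear_combination A * hd + B * c
  · apply mul_left_cancel₀ hR; linear_combination B * hd - A * c

def bder (A B : ℝ) (z : ℝ × ℝ) : ℝ × ℝ →L[ℝ] ℝ × ℝ :=
  (Matrix.toLin (.finTwoProd ℝ) (.finTwoProd ℝ)
    !![z.1 / bn1 z - (A - z.1) / bn2 A B z, z.2 / bn1 z - (B - z.2) / bn2 A B z;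
       z.1 / bn1 z + (A - z.1) / bn2 A B z, z.2 / bn1 z + (B - z.2) / bn2 A B z]).toContinuousLinearMap

lemma bder_det {A B : ℝ} {z : ℝ × ℝ} (h : bcr A B z ≠ 0) : |(bder A B z).det| = 2 * bsn A B z := by
  have h1 := bn1_pos h
  have h2 := bn2_pos h
  have : (bder A B z).det = 2 * (bcr A B z / (bn1 z * bn2 A B z)) := by
    unfold bder bcr
    simp only [LinearMap.det_toContinuousLinearMap, LinearMap.det_toLin, Matrix.det_fin_two_of]
    field_simp; ring
  rw [this, abs_mul, abs_div, abs_of_pos (mul_pos h1 h2), abs_two, bsn]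

lemma bder_has {A B : ℝ} {z : ℝ × ℝ} (h : bcr A B z ≠ 0) :
    HasFDerivAt (bmap A B) (bder A B z) z := by
  have h1 := bn1_pos h
  have h2 := bn2_pos h
  have f1 : HasFDerivAt (fun z : ℝ × ℝ => z.1) (ContinuousLinearMap.fst ℝ ℝ ℝ) z := hasFDerivAt_fst
  have f2 : HasFDerivAt (fun z : ℝ × ℝ => z.2) (ContinuousLinearMap.snd ℝ ℝ ℝ) z := hasFDerivAt_snd
  have d1 : HasFDerivAt bn1 _ z := ((f1.pow 2).add (f2.pow 2)).sqrt (Real.sqrt_pos.1 h1).ne'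
  have d2 : HasFDerivAt (bn2 A B) _ z :=
    (((f1.const_sub A).pow 2).add ((f2.const_sub B).pow 2)).sqrt (Real.sqrt_pos.1 h2).ne'
  have d := (d1.add d2).prodMk (d1.sub d2)
  unfold bder
  rw [Matrix.toLin_finTwoProd_toContinuousLinearMap]
  have e1 : √(z.1 ^ 2 + z.2 ^ 2) = bn1 z := rfl
  have e2 : √((A - z.1) ^ 2 + (B - z.2) ^ 2) = bn2 A B z := rfl
  refine d.congr_fderiv ?_
  ext <;> simp [e1, e2] <;> field_simp <;> ring

lemma bmeas_cr (A B : ℝ) : Measurable (bcr A B) := by unfold bcr; fun_prop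

lemma bipolar (A B : ℝ) (g : ℝ × ℝ → ℝ≥0∞) :
    ∫⁻ z : ℝ × ℝ, ENNReal.ofReal (bsn A B z) * g (bmap A B z) ≤
      ∫⁻ q in Set.Ioi (√(A ^ 2 + B ^ 2)) ×ˢ {v : ℝ | |v| < √(A ^ 2 + B ^ 2)}, g q := by
  set T := Set.Ioi (√(A ^ 2 + B ^ 2)) ×ˢ {v : ℝ | |v| < √(A ^ 2 + B ^ 2)}
  have key : ∀ S : Set (ℝ × ℝ), MeasurableSet S → (∀ z ∈ S, bcr A B z ≠ 0) →
      (∀ z ∈ S, ∀ z' ∈ S, 0 < bcr A B z * bcr A B z') →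
      2 * ∫⁻ z in S, ENNReal.ofReal (bsn A B z) * g (bmap A B z) ≤ ∫⁻ q in T, g q := by
    intro S hS h0 hpos
    have := lintegral_image_eq_lintegral_abs_det_fderiv_mul volume hS
      (fun z hz => (bder_has (h0 z hz)).hasFDerivWithinAt)
      (fun z hz z' hz' he => bmap_inj (hpos z hz z' hz') he) g
    have e : ∫⁻ z in S, ENNReal.ofReal |(bder A B z).det| * g (bmap A B z) =
        ∫⁻ z in S, 2 * (ENNReal.ofReal (bsn A B z) * g (bmap A B z)) := by
      apply setLIntegral_congr_fun hS
      intro z hz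
      simp only
      rw [bder_det (h0 z hz), ENNReal.ofReal_mul (by norm_num), mul_assoc]; simp
    rw [e, lintegral_const_mul' _ _ (by simp)] at this
    rw [← this]
    apply lintegral_mono_set
    rintro _ ⟨z, hz, rfl⟩
    exact bmap_region (h0 z hz)
  set f := fun z => ENNReal.ofReal (bsn A B z) * g (bmap A B z)
  set S1 := {z | 0 < bcr A B z}
  set S2 := {z | bcr A B z < 0}
  have m1 : MeasurableSet S1 := measurableSet_lt measurable_const (bmeas_cr A B)
  have m2 : MeasurableSet S2 := measurableSet_lt (bmeas_cr A B) measurable_const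
  have k1 := key S1 m1 (fun z hz => ne_of_gt hz) (fun z hz z' hz' => mul_pos hz hz')
  have k2 := key S2 m2 (fun z hz => ne_of_lt hz) (fun z hz z' hz' => mul_pos_of_neg_of_neg hz hz')
  have : ∫⁻ z, f z ≤ (∫⁻ z in S1, f z) + ∫⁻ z in S2, f z := by
    have : ∫⁻ z, f z = ∫⁻ z in S1 ∪ S2, f z := by
      rw [← lintegral_indicator (m1.union m2)]
      congr 1; ext z
      by_cases hz : z ∈ S1 ∪ S2
      · simp [hz]
      · rw [Set.indicator_of_notMem hz]
        have : bcr A B z = 0 := by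
          simp [S1, S2] at hz; exact hz.symm
        simp [f, bsn, this]
    rw [this]; exact lintegral_union_le _ _ _
  have h2 : 2 * ∫⁻ z, f z ≤ 2 * ∫⁻ q in T, g q := by
    calc 2 * ∫⁻ z, f z ≤ 2 * ((∫⁻ z in S1, f z) + ∫⁻ z in S2, f z) := by gcongr
      _ = 2 * (∫⁻ z in S1, f z) + 2 * ∫⁻ z in S2, f z := by rw [mul_add]
      _ ≤ (∫⁻ q in T, g q) + ∫⁻ q in T, g q := add_le_add k1 k2
      _ = _ := by rw [two_mul]
  rwa [ENNReal.mul_le_mul_iff_right (by simp) (by simp)] at h2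
/-- The one-dimensional constant. -/
def Jc (p : ℝ) : ℝ≥0∞ := ∫⁻ x : ℝ, ENNReal.ofReal ((1 + |x|) ^ (-p))

lemma Jc_ne_top {p : ℝ} (hp : 1 < p) : Jc p ≠ ⊤ := by
  have : Integrable (fun x : ℝ => (1 + ‖x‖) ^ (-p)) volume := integrable_one_add_norm (by simpa using hp)
  have h := this.lintegral_lt_top
  exact h.ne

lemma Jc_shift (p τ e : ℝ) (he : e = 1 ∨ e = -1) :
    ∫⁻ x : ℝ, ENNReal.ofReal ((1 + |τ - e * x|) ^ (-p)) = Jc p := by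
  unfold Jc
  rcases he with rfl | rfl
  · simp only [one_mul]
    exact lintegral_sub_left_eq_self (fun x => ENNReal.ofReal ((1 + |x|) ^ (-p))) τ
  · simp only [neg_mul, one_mul, sub_neg_eq_add]
    exact lintegral_add_left_eq_self (fun x => ENNReal.ofReal ((1 + |x|) ^ (-p))) τ

lemma int_sym {a R u : ℝ} (ha' : a < 1/2) (hu : R < u) :
    ∫⁻ v in {v : ℝ | |v| < R}, ENNReal.ofReal ((u - R) ^ (1/2 - a) * (u - |v|) ^ (a - 3/2))
      ≤ 2 * ENNReal.ofReal (1 / (1/2 - a)) := by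
  have hw : 0 < u - R := by linarith
  have h1 := int_one (a := a) (w := u - R) (c := -R) ha' hw
  set G : ℝ → ℝ≥0∞ := fun t => ENNReal.ofReal ((u - R) ^ (1/2 - a) * (t + u) ^ (a - 3/2)) with hG
  have e : ∀ t, ENNReal.ofReal ((u - R) ^ (1/2 - a) * (t - -R + (u - R)) ^ (a - 3/2)) = G t := by
    intro t; simp only [hG]; ring_nf
  simp_rw [e] at h1
  have hmeas : Measurable G := by simp only [hG]; fun_prop
  have h2 : ∫⁻ t in Set.Iio R, G (-t) = ∫⁻ t in Set.Ioi (-R), G t := by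
    have := (Measure.measurePreserving_neg (volume : Measure ℝ)).setLIntegral_comp_preimage
      (measurableSet_Ioi (a := -R)) hmeas
    rw [← this]; congr 2; ext x; simp
  calc _ ≤ ∫⁻ v in {v : ℝ | |v| < R}, (G v + G (-v)) := by
        apply lintegral_mono; intro v
        rcases abs_cases v with ⟨h, _⟩ | ⟨h, _⟩
        · refine le_add_left ?_
          simp only [hG, h]; ring_nf; rfl
        · refine le_add_right ?_
          simp only [hG, h]; ring_nf; rfl
    _ = (∫⁻ v in {v : ℝ | |v| < R}, G v) + ∫⁻ v in {v : ℝ | |v| < R}, G (-v) :=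
        lintegral_add_left hmeas _
    _ ≤ (∫⁻ v in Set.Ioi (-R), G v) + ∫⁻ v in Set.Iio R, G (-v) := by
        apply add_le_add
        · apply lintegral_mono_set; intro v hv; simp only [Set.mem_ofPred_eq, abs_lt] at hv; exact hv.1
        · apply lintegral_mono_set; intro v hv; simp only [Set.mem_ofPred_eq, abs_lt] at hv; exact hv.2
    _ ≤ _ := by rw [h2, two_mul]; exact add_le_add h1 h1

lemma meas_abs_lt (R : ℝ) : MeasurableSet {v : ℝ | |v| < R} :=
  measurableSet_lt (by fun_prop) measurable_const

/-- the constant of the two-dimensional estimate -/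
def Kc (a p : ℝ) : ℝ≥0∞ := 12 * (2 * ENNReal.ofReal (1 / (1/2 - a))) * Jc p

lemma Kc_ne_top (a : ℝ) {p : ℝ} (hp : 1 < p) : Kc a p ≠ ⊤ := by
  unfold Kc
  exact ENNReal.mul_ne_top (ENNReal.mul_ne_top (by simp) (ENNReal.mul_ne_top (by simp) (by simp))) (Jc_ne_top hp)

lemma two_d_pp {a p : ℝ} (ha : 0 ≤ a) (ha' : a < 1/2) (A B τ e : ℝ) (he : e = 1 ∨ e = -1) :
    ∫⁻ z : ℝ × ℝ, ENNReal.ofReal (bsn A B z ^ 2 * (bn1 z ^ (a-1) + bn2 A B z ^ (a-1)) *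
      |(|e * (bmap A B z).1| - √(A^2+B^2))| ^ (-a) * (1 + |τ - e * (bmap A B z).1|) ^ (-p))
      ≤ Kc a p := by
  set R := √(A^2+B^2) with hR
  set g : ℝ × ℝ → ℝ≥0∞ := fun q => 12 * (ENNReal.ofReal ((1 + |τ - e * q.1|) ^ (-p)) *
    ENNReal.ofReal ((q.1 - R) ^ (1/2 - a) * (q.1 - |q.2|) ^ (a - 3/2))) with hg
  have hgm : Measurable g := by simp only [hg]; fun_prop
  calc _ ≤ ∫⁻ z : ℝ × ℝ, ENNReal.ofReal (bsn A B z) * g (bmap A B z) := by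
        apply lintegral_mono; intro z
        by_cases h : bcr A B z = 0
        · simp [bsn, h]
        obtain ⟨r1, r2⟩ := bmap_region h
        have hRp := bR_pos h
        have H := aux_pp hRp r1 r2 (n1 := bn1 z) (n2 := bn2 A B z) (by simp [bmap]; ring)
          (by simp [bmap]; ring) (bsn_heron h)
        have hs0 : 0 ≤ bsn A B z := by
          have := bn1_pos h; have := bn2_pos h; unfold bsn; positivity
        rw [← hR] at *
        have C := aux_core ha ha' (sub_pos.2 r1) (sub_pos.2 (r2.trans r1))
          (n1 := bn1 z) (n2 := bn2 A B z)
          (by have := neg_abs_le (bmap A B z).2; simp [bmap] at *; linarith)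
          (by have := le_abs_self (bmap A B z).2; simp [bmap] at *; linarith) hs0 H
        have ee : |(|e * (bmap A B z).1| - R)| = (bmap A B z).1 - R := by
          have h1 : |e| = 1 := by rcases he with rfl | rfl <;> simp
          rw [abs_mul, h1, one_mul, abs_of_pos (hRp.trans r1), abs_of_pos (sub_pos.2 r1)]
        simp only [hg]
        rw [ee, show (12:ℝ≥0∞) = ENNReal.ofReal 12 by simp,
          ← ENNReal.ofReal_mul (by positivity), ← ENNReal.ofReal_mul (by positivity),
          ← ENNReal.ofReal_mul (by positivity)]
        apply ENNReal.ofReal_le_ofReal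
        calc _ = bsn A B z * (1 + |τ - e * (bmap A B z).1|) ^ (-p) * (bsn A B z * (bn1 z ^ (a-1) + bn2 A B z ^ (a-1)) *
             ((bmap A B z).1 - R) ^ (-a)) := by ring
          _ ≤ bsn A B z * (1 + |τ - e * (bmap A B z).1|) ^ (-p) * _ :=
              mul_le_mul_of_nonneg_left C (by positivity)
          _ = _ := by ring
    _ ≤ ∫⁻ q in Set.Ioi R ×ˢ {v : ℝ | |v| < R}, g q := bipolar A B g
    _ = ∫⁻ u in Set.Ioi R, ∫⁻ v in {v : ℝ | |v| < R}, g (u, v) := by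
        rw [Measure.volume_eq_prod, ← Measure.prod_restrict, lintegral_prod _ hgm.aemeasurable]
    _ ≤ ∫⁻ u in Set.Ioi R, (12 * (2 * ENNReal.ofReal (1 / (1/2 - a)))) *
          ENNReal.ofReal ((1 + |τ - e * u|) ^ (-p)) := by
        apply setLIntegral_mono' measurableSet_Ioi
        intro u hu
        simp only [hg]
        rw [lintegral_const_mul' _ _ (by simp), lintegral_const_mul' _ _ (by simp)]
        rw [mul_comm (ENNReal.ofReal _), ← mul_assoc]
        gcongr
        exact int_sym ha' hu
    _ ≤ ∫⁻ u : ℝ, (12 * (2 * ENNReal.ofReal (1 / (1/2 - a)))) *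
          ENNReal.ofReal ((1 + |τ - e * u|) ^ (-p)) := setLIntegral_le_lintegral _ _
    _ = Kc a p := by
        rw [lintegral_const_mul' _ _ (ENNReal.mul_ne_top (by simp) (ENNReal.mul_ne_top (by simp) (by simp))),
          Jc_shift p τ e he, Kc]

lemma two_d_pm {a p : ℝ} (ha : 0 ≤ a) (ha' : a < 1/2) (A B τ e : ℝ) (he : e = 1 ∨ e = -1) :
    ∫⁻ z : ℝ × ℝ, ENNReal.ofReal (bsn A B z ^ 2 * (bn1 z ^ (a-1) + bn2 A B z ^ (a-1)) *
      |(|e * (bmap A B z).2| - √(A^2+B^2))| ^ (-a) * (1 + |τ - e * (bmap A B z).2|) ^ (-p))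
      ≤ Kc a p := by
  set R := √(A^2+B^2) with hR
  set g : ℝ × ℝ → ℝ≥0∞ := fun q => 12 * (ENNReal.ofReal ((1 + |τ - e * q.2|) ^ (-p)) *
    ENNReal.ofReal ((R - |q.2|) ^ (1/2 - a) * (q.1 - |q.2|) ^ (a - 3/2))) with hg
  have hgm : Measurable g := by simp only [hg]; fun_prop
  calc _ ≤ ∫⁻ z : ℝ × ℝ, ENNReal.ofReal (bsn A B z) * g (bmap A B z) := by
        apply lintegral_mono; intro z
        by_cases h : bcr A B z = 0
        · simp [bsn, h]
        obtain ⟨r1, r2⟩ := bmap_region h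
        have hRp := bR_pos h
        have H := aux_pm hRp r1 r2 (n1 := bn1 z) (n2 := bn2 A B z) (by simp [bmap]; ring)
          (by simp [bmap]; ring) (bsn_heron h)
        have hs0 : 0 ≤ bsn A B z := by
          have := bn1_pos h; have := bn2_pos h; unfold bsn; positivity
        rw [← hR] at *
        have C := aux_core ha ha' (sub_pos.2 r2) (sub_pos.2 (r2.trans r1))
          (n1 := bn1 z) (n2 := bn2 A B z)
          (by have := neg_abs_le (bmap A B z).2; simp [bmap] at *; linarith)
          (by have := le_abs_self (bmap A B z).2; simp [bmap] at *; linarith) hs0 H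
        have ee : |(|e * (bmap A B z).2| - R)| = R - |(bmap A B z).2| := by
          have h1 : |e| = 1 := by rcases he with rfl | rfl <;> simp
          rw [abs_mul, h1, one_mul, abs_sub_comm, abs_of_pos (sub_pos.2 r2)]
        simp only [hg]
        rw [ee, show (12:ℝ≥0∞) = ENNReal.ofReal 12 by simp,
          ← ENNReal.ofReal_mul (by positivity), ← ENNReal.ofReal_mul (by positivity),
          ← ENNReal.ofReal_mul (by positivity)]
        apply ENNReal.ofReal_le_ofReal
        calc _ = bsn A B z * (1 + |τ - e * (bmap A B z).2|) ^ (-p) * (bsn A B z * (bn1 z ^ (a-1) + bn2 A B z ^ (a-1)) *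
             (R - |(bmap A B z).2|) ^ (-a)) := by ring
          _ ≤ bsn A B z * (1 + |τ - e * (bmap A B z).2|) ^ (-p) * _ :=
              mul_le_mul_of_nonneg_left C (by positivity)
          _ = _ := by ring
    _ ≤ ∫⁻ q in Set.Ioi R ×ˢ {v : ℝ | |v| < R}, g q := bipolar A B g
    _ = ∫⁻ v in {v : ℝ | |v| < R}, ∫⁻ u in Set.Ioi R, g (u, v) := by
        rw [Measure.volume_eq_prod, ← Measure.prod_restrict, lintegral_prod_symm _ hgm.aemeasurable]
    _ ≤ ∫⁻ v in {v : ℝ | |v| < R}, (12 * (2 * ENNReal.ofReal (1 / (1/2 - a)))) *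
          ENNReal.ofReal ((1 + |τ - e * v|) ^ (-p)) := by
        apply setLIntegral_mono' (meas_abs_lt R)
        intro v hv
        simp only [hg]
        rw [lintegral_const_mul' _ _ (by simp), lintegral_const_mul' _ _ (by simp)]
        rw [mul_comm (ENNReal.ofReal _), ← mul_assoc]
        gcongr
        have := int_one (a := a) (w := R - |v|) (c := R) ha' (sub_pos.2 hv)
        refine le_trans (le_of_eq ?_) (this.trans ?_)
        · congr 1; ext u; ring_nf
        · rw [two_mul]; exact le_add_right le_rfl
    _ ≤ ∫⁻ u : ℝ, (12 * (2 * ENNReal.ofReal (1 / (1/2 - a)))) *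
          ENNReal.ofReal ((1 + |τ - e * u|) ^ (-p)) := setLIntegral_le_lintegral _ _
    _ = Kc a p := by
        rw [lintegral_const_mul' _ _ (ENNReal.mul_ne_top (by simp) (ENNReal.mul_ne_top (by simp) (by simp))),
          Jc_shift p τ e he, Kc]
lemma br_mul {P : ℝ} (hP : 0 ≤ P) (x y : ℝ) :
    (1 + |x|) ^ (-P) * (1 + |y|) ^ (-P) ≤
      2 ^ P * (1 + |x + y|) ^ (-P) * ((1 + |x|) ^ (-P) + (1 + |y|) ^ (-P)) := by
  have key : ∀ x y : ℝ, |y| ≤ |x| → (1 + |x|) ^ (-P) ≤ 2 ^ P * (1 + |x + y|) ^ (-P) := by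
    intro x y h
    have h1 : (1 + |x + y|) / 2 ≤ 1 + |x| := by linarith [abs_add_le x y]
    have h2 : (1 + |x|) ^ (-P) ≤ ((1 + |x + y|) / 2) ^ (-P) :=
      Real.rpow_le_rpow_of_nonpos (by positivity) h1 (by linarith)
    refine h2.trans (le_of_eq ?_)
    rw [Real.div_rpow (by positivity) (by norm_num), Real.rpow_neg (x := 2) (by norm_num)]
    field_simp
  have p1 : 0 ≤ (1 + |x|) ^ (-P) := by positivity
  have p2 : 0 ≤ (1 + |y|) ^ (-P) := by positivity
  rcases le_total |y| |x| with h | h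
  · have := key x y h
    nlinarith [mul_le_mul_of_nonneg_right this p2, mul_nonneg (p1.trans this) p1]
  · have := key y x h
    rw [add_comm y x] at this
    nlinarith [mul_le_mul_of_nonneg_right this p1, mul_nonneg (p2.trans this) p2]

lemma br_sign (P τ ρ : ℝ) :
    (1 + |(|τ| - ρ)|) ^ (-P) ≤ (1 + |τ - ρ|) ^ (-P) + (1 + |τ + ρ|) ^ (-P) := by
  have p1 : 0 ≤ (1 + |τ - ρ|) ^ (-P) := by positivity
  have p2 : 0 ≤ (1 + |τ + ρ|) ^ (-P) := by positivity
  rcases abs_cases τ with ⟨h, _⟩ | ⟨h, _⟩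
  · rw [h]; linarith
  · rw [h, show -τ - ρ = -(τ + ρ) by ring, abs_neg]; linarith

def C1 (P : ℝ) : ℝ≥0∞ := ENNReal.ofReal (2 ^ P) * (2 * Jc P)

lemma C1_ne_top {P : ℝ} (hP : 1 < P) : C1 P ≠ ⊤ :=
  ENNReal.mul_ne_top (by simp) (ENNReal.mul_ne_top (by simp) (Jc_ne_top hP))

lemma conv1 {P : ℝ} (hP : 0 ≤ P) (τ α β : ℝ) :
    ∫⁻ t : ℝ, ENNReal.ofReal ((1 + |t - α|) ^ (-P) * (1 + |τ - t - β|) ^ (-P)) ≤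
      C1 P * ENNReal.ofReal ((1 + |τ - (α + β)|) ^ (-P)) := by
  have j1 : ∫⁻ t : ℝ, ENNReal.ofReal ((1 + |t - α|) ^ (-P)) = Jc P :=
    lintegral_sub_right_eq_self (fun x => ENNReal.ofReal ((1 + |x|) ^ (-P))) α
  have j2 : ∫⁻ t : ℝ, ENNReal.ofReal ((1 + |τ - t - β|) ^ (-P)) = Jc P := by
    rw [← Jc_shift P (τ - β) 1 (Or.inl rfl)]
    congr 1; ext t; ring_nf
  calc _ ≤ ∫⁻ t : ℝ, ENNReal.ofReal (2 ^ P * (1 + |τ - (α + β)|) ^ (-P)) *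
        (ENNReal.ofReal ((1 + |t - α|) ^ (-P)) + ENNReal.ofReal ((1 + |τ - t - β|) ^ (-P))) := by
        apply lintegral_mono; intro t
        beta_reduce
        rw [← ENNReal.ofReal_add (by positivity) (by positivity), ← ENNReal.ofReal_mul (by positivity)]
        apply ENNReal.ofReal_le_ofReal
        have := br_mul hP (t - α) (τ - t - β)
        rwa [show t - α + (τ - t - β) = τ - (α + β) by ring] at this
    _ = ENNReal.ofReal (2 ^ P * (1 + |τ - (α + β)|) ^ (-P)) * (Jc P + Jc P) := by
        rw [lintegral_const_mul' _ _ (by simp), lintegral_add_left (by fun_prop), j1, j2]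
    _ = _ := by
        rw [ENNReal.ofReal_mul (by positivity), C1]; ring

lemma conv4 {P : ℝ} (hP : 0 ≤ P) (τ ρ r : ℝ) :
    ∫⁻ t : ℝ, ENNReal.ofReal ((1 + |(|t| - ρ)|) ^ (-P) * (1 + |(|τ - t| - r)|) ^ (-P)) ≤
      C1 P * (ENNReal.ofReal ((1 + |τ - 1 * (ρ + r)|) ^ (-P)) +
        ENNReal.ofReal ((1 + |τ - (-1) * (ρ + r)|) ^ (-P)) +
        ENNReal.ofReal ((1 + |τ - 1 * (ρ - r)|) ^ (-P)) +
        ENNReal.ofReal ((1 + |τ - (-1) * (ρ - r)|) ^ (-P))) := by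
  set f : ℝ → ℝ → ℝ → ℝ≥0∞ := fun α β t =>
    ENNReal.ofReal ((1 + |t - α|) ^ (-P) * (1 + |τ - t - β|) ^ (-P)) with hf
  have hm : ∀ α β, Measurable (f α β) := by intro α β; simp only [hf]; fun_prop
  calc _ ≤ ∫⁻ t : ℝ, (f ρ r t + f (-ρ) (-r) t + f ρ (-r) t + f (-ρ) r t) := by
        apply lintegral_mono; intro t
        simp only [hf]
        rw [← ENNReal.ofReal_add (by positivity) (by positivity),
          ← ENNReal.ofReal_add (by positivity) (by positivity),
          ← ENNReal.ofReal_add (by positivity) (by positivity)]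
        apply ENNReal.ofReal_le_ofReal
        calc _ ≤ ((1 + |t - ρ|) ^ (-P) + (1 + |t + ρ|) ^ (-P)) *
              ((1 + |τ - t - r|) ^ (-P) + (1 + |τ - t + r|) ^ (-P)) := by
              gcongr
              · exact br_sign P t ρ
              · exact br_sign P (τ - t) r
          _ = _ := by simp only [sub_neg_eq_add]; ring
    _ = (∫⁻ t, f ρ r t) + (∫⁻ t, f (-ρ) (-r) t) + (∫⁻ t, f ρ (-r) t) + ∫⁻ t, f (-ρ) r t := by
        rw [lintegral_add_right _ (hm _ _), lintegral_add_right _ (hm _ _), lintegral_add_right _ (hm _ _)]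
    _ ≤ _ := by
        rw [mul_add, mul_add, mul_add]
        gcongr
        · exact (conv1 hP τ _ _).trans (le_of_eq (by ring_nf))
        · exact (conv1 hP τ _ _).trans (le_of_eq (by ring_nf))
        · exact (conv1 hP τ _ _).trans (le_of_eq (by ring_nf))
        · exact (conv1 hP τ _ _).trans (le_of_eq (by ring_nf))

lemma br_move {a P : ℝ} (ha : 0 ≤ a) (τ σ R : ℝ) (hne : |σ| - R ≠ 0) :
    (1 + |(|τ| - R)|) ^ (-a) * (1 + |τ - σ|) ^ (-P) ≤
      |(|σ| - R)| ^ (-a) * (1 + |τ - σ|) ^ (-(P - a)) := by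
  have h1 : 0 < |(|σ| - R)| := abs_pos.2 hne
  have h2 : |(|σ| - R)| ≤ (1 + |(|τ| - R)|) * (1 + |τ - σ|) := by
    have a1 : |(|σ| - R)| ≤ |(|τ| - R)| + |τ - σ| := by
      have := abs_abs_sub_abs_le τ σ
      rw [abs_sub_comm] at this
      calc _ = |(|τ| - R) + (|σ| - |τ|)| := by ring_nf
        _ ≤ _ := (abs_add_le _ _).trans (by linarith)
    nlinarith [abs_nonneg (|τ| - R), abs_nonneg (τ - σ),
      mul_nonneg (abs_nonneg (|τ| - R)) (abs_nonneg (τ - σ))]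
  have h3 : ((1 + |(|τ| - R)|) * (1 + |τ - σ|)) ^ (-a) ≤ |(|σ| - R)| ^ (-a) :=
    Real.rpow_le_rpow_of_nonpos h1 h2 (by linarith)
  rw [Real.mul_rpow (by positivity) (by positivity)] at h3
  have e : (1 + |τ - σ|) ^ (-P) = (1 + |τ - σ|) ^ (-a) * (1 + |τ - σ|) ^ (-(P - a)) := by
    rw [← Real.rpow_add (by positivity)]; ring_nf
  rw [e, ← mul_assoc]
  gcongr

lemma bmeas1 : Measurable bn1 := by unfold bn1; fun_prop
lemma bmeas2 (A B : ℝ) : Measurable (bn2 A B) := by unfold bn2; fun_prop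
lemma bmeas_sn (A B : ℝ) : Measurable (bsn A B) := by
  have h1 := bmeas1
  have h2 := bmeas2 A B
  have h3 := bmeas_cr A B
  unfold bsn; fun_prop

/-- weight in front -/
def bwt (a A B : ℝ) (z : ℝ × ℝ) : ℝ := bsn A B z ^ 2 * (bn1 z ^ (a-1) + bn2 A B z ^ (a-1))

lemma bwt_nonneg (a A B : ℝ) (z : ℝ × ℝ) : 0 ≤ bwt a A B z := by
  have : 0 ≤ bn1 z := Real.sqrt_nonneg _
  have : 0 ≤ bn2 A B z := Real.sqrt_nonneg _
  unfold bwt; positivity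

lemma key_coord {a P : ℝ} (ha : 0 ≤ a) (ha' : a < 1/2) (hP : 0 ≤ P) (τ A B : ℝ) :
    ∫⁻ z : ℝ × ℝ, ∫⁻ t : ℝ, ENNReal.ofReal (bwt a A B z * (1 + |(|τ| - √(A^2+B^2))|) ^ (-a) *
      ((1 + |(|t| - bn1 z)|) ^ (-P) * (1 + |(|τ - t| - bn2 A B z)|) ^ (-P)))
    ≤ C1 P * (4 * Kc a (P - a)) := by
  set R := √(A^2+B^2) with hR
  set F1 : ℝ → ℝ × ℝ → ℝ≥0∞ := fun e z => ENNReal.ofReal (bwt a A B z *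
      |(|e * (bmap A B z).1| - R)| ^ (-a) * (1 + |τ - e * (bmap A B z).1|) ^ (-(P - a))) with hF1
  set F2 : ℝ → ℝ × ℝ → ℝ≥0∞ := fun e z => ENNReal.ofReal (bwt a A B z *
      |(|e * (bmap A B z).2| - R)| ^ (-a) * (1 + |τ - e * (bmap A B z).2|) ^ (-(P - a))) with hF2
  have m1 := bmeas1
  have m2 := bmeas2 A B
  have m3 := bmeas_sn A B
  have hm1 : ∀ e, Measurable (F1 e) := by intro e; simp only [hF1, bwt, bmap]; fun_prop
  have hm2 : ∀ e, Measurable (F2 e) := by intro e; simp only [hF2, bwt, bmap]; fun_prop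
  calc _ ≤ ∫⁻ z : ℝ × ℝ, C1 P * (F1 1 z + F1 (-1) z + F2 1 z + F2 (-1) z) := by
        apply lintegral_mono; intro z
        have hw0 := bwt_nonneg a A B z
        by_cases h : bcr A B z = 0
        · simp [bwt, bsn, h]
        obtain ⟨r1, r2⟩ := bmap_region h
        have hRp := bR_pos h
        rw [← hR] at r1 r2 hRp
        have n1 : ∀ e : ℝ, |e| = 1 → |e * (bmap A B z).1| - R ≠ 0 := by
          intro e he
          rw [abs_mul, he, one_mul, abs_of_pos (hRp.trans r1)]; exact (sub_pos.2 r1).ne'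
        have n2 : ∀ e : ℝ, |e| = 1 → |e * (bmap A B z).2| - R ≠ 0 := by
          intro e he
          rw [abs_mul, he, one_mul]; exact (sub_neg.2 r2).ne
        have g : ∀ σ : ℝ, |σ| - R ≠ 0 →
            ENNReal.ofReal (bwt a A B z * (1 + |(|τ| - R)|) ^ (-a)) *
              ENNReal.ofReal ((1 + |τ - σ|) ^ (-P)) ≤
            ENNReal.ofReal (bwt a A B z * |(|σ| - R)| ^ (-a) * (1 + |τ - σ|) ^ (-(P - a))) := by
          intro σ hσ
          rw [← ENNReal.ofReal_mul (by positivity)]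
          apply ENNReal.ofReal_le_ofReal
          rw [mul_assoc, mul_assoc]
          exact mul_le_mul_of_nonneg_left (br_move ha τ σ R hσ) hw0
        have c4 := conv4 hP τ (bn1 z) (bn2 A B z)
        calc _ = ENNReal.ofReal (bwt a A B z * (1 + |(|τ| - R)|) ^ (-a)) * _ := by
              rw [← lintegral_const_mul' _ _ (by simp)]
              apply lintegral_congr; intro t
              rw [← ENNReal.ofReal_mul (by positivity)]
          _ ≤ ENNReal.ofReal (bwt a A B z * (1 + |(|τ| - R)|) ^ (-a)) * _ :=
              mul_le_mul' le_rfl c4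
          _ = C1 P * (ENNReal.ofReal (bwt a A B z * (1 + |(|τ| - R)|) ^ (-a)) * ENNReal.ofReal ((1 + |τ - 1 * (bn1 z + bn2 A B z)|) ^ (-P)) +
              ENNReal.ofReal (bwt a A B z * (1 + |(|τ| - R)|) ^ (-a)) * ENNReal.ofReal ((1 + |τ - (-1) * (bn1 z + bn2 A B z)|) ^ (-P)) +
              ENNReal.ofReal (bwt a A B z * (1 + |(|τ| - R)|) ^ (-a)) * ENNReal.ofReal ((1 + |τ - 1 * (bn1 z - bn2 A B z)|) ^ (-P)) +
              ENNReal.ofReal (bwt a A B z * (1 + |(|τ| - R)|) ^ (-a)) * ENNReal.ofReal ((1 + |τ - (-1) * (bn1 z - bn2 A B z)|) ^ (-P))) := by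
              ring
          _ ≤ C1 P * (F1 1 z + F1 (-1) z + F2 1 z + F2 (-1) z) := by
              gcongr
              · exact g _ (n1 1 (by simp))
              · exact g _ (n1 (-1) (by simp))
              · exact g _ (n2 1 (by simp))
              · exact g _ (n2 (-1) (by simp))
    _ = C1 P * ((∫⁻ z, F1 1 z) + (∫⁻ z, F1 (-1) z) + (∫⁻ z, F2 1 z) + ∫⁻ z, F2 (-1) z) := by
        rw [lintegral_const_mul _ (by fun_prop), lintegral_add_right _ (hm2 _),
          lintegral_add_right _ (hm2 _), lintegral_add_right _ (hm1 _)]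
    _ ≤ C1 P * (Kc a (P - a) + Kc a (P - a) + Kc a (P - a) + Kc a (P - a)) := by
        gcongr
        · exact two_d_pp ha ha' A B τ 1 (Or.inl rfl)
        · exact two_d_pp ha ha' A B τ (-1) (Or.inr rfl)
        · exact two_d_pm ha ha' A B τ 1 (Or.inl rfl)
        · exact two_d_pm ha ha' A B τ (-1) (Or.inr rfl)
    _ = _ := by ring
abbrev W3 : Type := WithLp 2 (ℝ × V2)

lemma haarI : (volume : Measure (ℝ × V2)).IsAddHaarMeasure :=
  inferInstanceAs ((volume : Measure ℝ).prod (volume : Measure V2)).IsAddHaarMeasure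

section fourier
open scoped FourierTransform SchwartzMap LineDeriv

lemma ft_mul (F G : 𝓢(W3, ℂ)) (x : W3) :
    𝓕 (fun w => F w * G w) x = ∫ t, 𝓕 F t * 𝓕 G (x - t) := by
  have hc : SchwartzMap.convolution (ContinuousLinearMap.mul ℂ ℂ) (𝓕 F) (𝓕 G) =
      𝓕 (SchwartzMap.pairing (ContinuousLinearMap.mul ℂ ℂ) F G) := by
    have hinj : Function.Injective (fun f : 𝓢(W3, ℂ) => 𝓕 f) := by
      intro f g h
      have := congrArg (fun f : 𝓢(W3, ℂ) => 𝓕⁻ f) h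
      simpa using this
    apply hinj
    have h2 : ∀ (f : 𝓢(W3, ℂ)) (y : W3), 𝓕 (𝓕 f) y = f (-y) := by
      intro f y
      have h3 : (𝓕⁻ (𝓕 f)) (-y) = f (-y) := by simp
      rw [← h3, SchwartzMap.fourierInv_coe, Real.fourierInv_eq_fourier_neg, neg_neg]
      rfl
    ext y
    beta_reduce
    rw [SchwartzMap.fourier_convolution, SchwartzMap.pairing_apply_apply, h2, h2, h2,
      SchwartzMap.pairing_apply_apply]
  have := congrArg (fun f : 𝓢(W3, ℂ) => f x) hc
  beta_reduce at this
  rw [SchwartzMap.convolution_apply] at this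
  rw [MeasureTheory.convolution_def] at this
  simp only [ContinuousLinearMap.mul_apply'] at this
  rw [this, SchwartzMap.fourier_coe]
  rfl

def L3 : W3 ≃L[ℝ] (ℝ × V2) := WithLp.prodContinuousLinearEquiv 2 ℝ ℝ V2

lemma L3_mp : MeasurePreserving (L3 : W3 → ℝ × V2) := WithLp.volume_preserving_ofLp _ _

lemma L3_emb : MeasurableEmbedding (L3 : W3 → ℝ × V2) :=
  L3.toHomeomorph.measurableEmbedding

def pull (f : 𝓢(ℝ × V2, ℂ)) : 𝓢(W3, ℂ) := SchwartzMap.compCLMOfContinuousLinearEquiv ℂ L3 f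

lemma pull_apply (f : 𝓢(ℝ × V2, ℂ)) (w : W3) : pull f w = f (L3 w) := rfl

lemma ftST_eq (u : ℝ × V2 → ℂ) (q : ℝ × V2) :
    ftST u q.1 q.2 = 𝓕 (fun w => u (L3 w)) ((2 * π)⁻¹ • L3.symm q) := by
  unfold ftST
  rw [← L3_mp.integral_comp L3_emb, Real.fourier_eq]
  congr 1
  ext w
  rw [Circle.smul_def, Real.fourierChar_apply, smul_eq_mul]
  congr 2
  have : ⟪w, (2 * π)⁻¹ • L3.symm q⟫ = (2 * π)⁻¹ * ((L3 w).1 * q.1 + ⟪(L3 w).2, q.2⟫) := by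
    rw [inner_smul_right, WithLp.prod_inner_apply]
    congr 2
    change q.1 * (L3 w).1 = _
    ring
  rw [this]
  have hpi : (π : ℂ) ≠ 0 := by exact_mod_cast Real.pi_ne_zero
  push_cast
  field_simp

def pdS (j : Fin 2) (φ : 𝓢(ℝ × V2, ℂ)) : 𝓢(ℝ × V2, ℂ) :=
  ∂_{((0:ℝ), EuclideanSpace.single j (1:ℝ))} φ

lemma pdS_apply (j : Fin 2) (φ : 𝓢(ℝ × V2, ℂ)) : (pdS j φ : ℝ × V2 → ℂ) = pdx j φ := by
  ext p
  exact SchwartzMap.lineDerivOp_apply_eq_fderiv _ _ _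

lemma ftST_pdx (j : Fin 2) (φ : 𝓢(ℝ × V2, ℂ)) (q : ℝ × V2) :
    ftST (pdx j φ) q.1 q.2 = Complex.I * (q.2 j : ℂ) * ftST φ q.1 q.2 := by
  rw [ftST_eq, ftST_eq]
  have h1 : (fun w => pdx j φ (L3 w)) =
      (∂_{(L3.symm ((0:ℝ), EuclideanSpace.single j (1:ℝ)))} (pull φ) : 𝓢(W3, ℂ)) := by
    ext w
    rw [SchwartzMap.lineDerivOp_apply_eq_fderiv]
    have : (pull φ : W3 → ℂ) = φ ∘ L3 := rfl
    rw [this, L3.comp_right_fderiv]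
    simp [pdx]
  have h2 := SchwartzMap.fourier_lineDerivOp_eq (pull φ)
    (L3.symm ((0:ℝ), EuclideanSpace.single j (1:ℝ)))
  rw [h1, ← SchwartzMap.fourier_coe, h2]
  have : (inner ℝ · (L3.symm ((0:ℝ), EuclideanSpace.single j (1:ℝ))) : W3 → ℝ).HasTemperateGrowth := by fun_prop
  rw [smul_apply, SchwartzMap.smulLeftCLM_apply_apply this]
  have h3 : ⟪(2 * π)⁻¹ • L3.symm q, L3.symm ((0:ℝ), EuclideanSpace.single j (1:ℝ))⟫ =
      (2 * π)⁻¹ * q.2 j := by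
    rw [inner_smul_left, WithLp.prod_inner_apply]
    change _ * (0 * q.1 + ⟪q.2, EuclideanSpace.single j (1:ℝ)⟫) = _
    simp [EuclideanSpace.inner_single_right]
  rw [h3]
  have h4 : 𝓕 (pull φ) = 𝓕 (fun w => φ (L3 w)) := rfl
  rw [h4]
  have hpi : (π : ℂ) ≠ 0 := by exact_mod_cast Real.pi_ne_zero
  simp only [smul_eq_mul, Complex.real_smul]
  push_cast
  field_simp

lemma ftST_cont (φ : 𝓢(ℝ × V2, ℂ)) : Continuous (fun q : ℝ × V2 => ftST φ q.1 q.2) := by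
  have : (fun q : ℝ × V2 => ftST φ q.1 q.2) = fun q => (𝓕 (pull φ)) ((2 * π)⁻¹ • L3.symm q) := by
    ext q; rw [ftST_eq]; rfl
  rw [this]
  exact (𝓕 (pull φ)).continuous.comp (by fun_prop)

lemma ftST_mul (f g : 𝓢(ℝ × V2, ℂ)) (q : ℝ × V2) :
    ftST (fun p => f p * g p) q.1 q.2 = (((2 * π)⁻¹ ^ 3 : ℝ) : ℂ) *
      ∫ p : ℝ × V2, ftST f p.1 p.2 * ftST g (q - p).1 (q - p).2 := by
  rw [ftST_eq]
  have := ft_mul (pull f) (pull g) ((2 * π)⁻¹ • L3.symm q)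
  simp only [pull_apply] at this
  rw [this]
  rw [← L3_mp.integral_comp L3_emb]
  have h := Measure.integral_comp_smul (μ := (volume : Measure W3))
    (fun t => 𝓕 (pull f) t * 𝓕 (pull g) ((2 * π)⁻¹ • L3.symm q - t)) (2 * π)⁻¹
  have hd : Module.finrank ℝ W3 = 3 := by
    rw [L3.toLinearEquiv.finrank_eq]; simp
  rw [hd] at h
  have e : ∀ w : W3, ftST f (L3 w).1 (L3 w).2 * ftST g (q - L3 w).1 (q - L3 w).2 =
      𝓕 (pull f) ((2 * π)⁻¹ • w) * 𝓕 (pull g) ((2 * π)⁻¹ • L3.symm q - (2 * π)⁻¹ • w) := by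
    intro w
    rw [ftST_eq, ftST_eq, ← smul_sub]
    simp only [map_sub, ContinuousLinearEquiv.symm_apply_apply]
    rfl
  simp_rw [e]
  rw [h, Complex.real_smul, ← mul_assoc, ← Complex.ofReal_mul]
  have hpos : 0 < ((2 * π)⁻¹ ^ 3 : ℝ) := by positivity
  rw [abs_of_pos (by positivity), mul_inv_cancel₀ hpos.ne', Complex.ofReal_one, one_mul]

lemma ftST_sub (f g f' g' : 𝓢(ℝ × V2, ℂ)) (q : ℝ × V2) :
    ftST (fun p => f p * g p - f' p * g' p) q.1 q.2 =
      ftST (fun p => f p * g p) q.1 q.2 - ftST (fun p => f' p * g' p) q.1 q.2 := by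
  have := haarI
  have hi : ∀ f g : 𝓢(ℝ × V2, ℂ), Integrable (fun p : ℝ × V2 =>
      Complex.exp (-Complex.I * ((p.1 * q.1 + ⟪p.2, q.2⟫ : ℝ) : ℂ)) * (f p * g p)) := by
    intro f g
    have h1 : Integrable (fun p : ℝ × V2 => f p * g p) :=
      (SchwartzMap.pairing (ContinuousLinearMap.mul ℂ ℂ) f g).integrable
    refine h1.bdd_mul (c := 1) ?_ ?_
    · exact Continuous.aestronglyMeasurable (by fun_prop)
    · refine Filter.Eventually.of_forall fun p => ?_
      rw [Complex.norm_exp]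
      simp
  unfold ftST
  rw [← integral_sub (hi f g) (hi f' g')]
  simp_rw [mul_sub]

def crs (x y : V2) : ℝ := x 0 * y 1 - x 1 * y 0

lemma ftST_Q12_le (φ ψ : 𝓢(ℝ × V2, ℂ)) (q : ℝ × V2) :
    ‖ftST (Q12 φ ψ) q.1 q.2‖ₑ ≤ ∫⁻ p : ℝ × V2, ENNReal.ofReal |crs p.2 (q - p).2| *
      (‖ftST φ p.1 p.2‖ₑ * ‖ftST ψ (q - p).1 (q - p).2‖ₑ) := by
  have := haarI
  have hi : ∀ f g : 𝓢(ℝ × V2, ℂ), Integrable (fun p : ℝ × V2 =>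
      ftST f p.1 p.2 * ftST g (q - p).1 (q - p).2) := by
    intro f g
    have h1 : ∀ w : 𝓢(ℝ × V2, ℂ), MemLp (fun q : ℝ × V2 => ftST w q.1 q.2) 2 := by
      intro w
      have : (fun q : ℝ × V2 => ftST w q.1 q.2) =
          (SchwartzMap.compCLMOfContinuousLinearEquiv ℂ (L3.symm.trans
            (ContinuousLinearEquiv.smulLeft (Units.mk0 ((2 * π)⁻¹) (by positivity))))
            (𝓕 (pull w)) : 𝓢(ℝ × V2, ℂ)) := by
        ext q; rw [ftST_eq]; rfl
      rw [this]
      exact SchwartzMap.memLp _ _ volume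
    exact (h1 f).integrable_mul ((h1 g).comp_measurePreserving
      (Measure.measurePreserving_sub_left volume q))
  have hQ : Q12 φ ψ = fun p => pdS 0 φ p * pdS 1 ψ p - pdS 1 φ p * pdS 0 ψ p := by
    simp only [pdS_apply]; rfl
  rw [hQ, ftST_sub, ftST_mul, ftST_mul, ← mul_sub, ← integral_sub (hi _ _) (hi _ _)]
  rw [enorm_mul]
  have hc : ‖(((2 * π)⁻¹ ^ 3 : ℝ) : ℂ)‖ₑ ≤ 1 := by
    rw [← ofReal_norm, Complex.norm_real, Real.norm_of_nonneg (by positivity)]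
    rw [ENNReal.ofReal_le_one]
    apply pow_le_one₀ (by positivity)
    apply inv_le_one_of_one_le₀
    nlinarith [Real.pi_gt_three]
  refine (mul_le_mul' hc (enorm_integral_le_lintegral_enorm _)).trans ?_
  rw [one_mul]
  apply lintegral_mono
  intro p
  beta_reduce
  simp only [pdS_apply, ftST_pdx]
  rw [← enorm_mul, ← Real.enorm_eq_ofReal_abs]
  have : ‖crs p.2 (q - p).2‖ₑ = ‖((crs p.2 (q - p).2 : ℝ) : ℂ)‖ₑ := by
    rw [← ofReal_norm, ← ofReal_norm, Complex.norm_real]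
  rw [this, ← enorm_mul, ← enorm_neg]
  apply le_of_eq
  congr 1
  unfold crs
  push_cast
  linear_combination (-(p.2 0 : ℂ) * ((q - p).2 1 : ℂ) + (p.2 1 : ℂ) * ((q - p).2 0 : ℂ)) * ftST φ p.1 p.2 * ftST ψ (q - p).1 (q - p).2 * Complex.I_sq

end fourier
def projV (x : V2) : ℝ × ℝ := (x 0, x 1)

lemma projV_mp : MeasurePreserving projV :=
  (volume_preserving_finTwoArrow ℝ).comp (PiLp.volume_preserving_ofLp (Fin 2))

lemma projV_emb : MeasurableEmbedding projV :=
  (MeasurableEquiv.finTwoArrow (α := ℝ)).measurableEmbedding.comp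
    (MeasurableEquiv.toLp 2 (Fin 2 → ℝ)).symm.measurableEmbedding

lemma normV (x : V2) : ‖x‖ = √(x 0 ^ 2 + x 1 ^ 2) := by
  rw [EuclideanSpace.norm_eq, Fin.sum_univ_two]; simp

lemma wgt_pos (s θ τ : ℝ) (ξ : V2) : 0 < wgt s θ τ ξ := by unfold wgt; positivity

lemma wgt_meas (s θ : ℝ) : Measurable (fun q : ℝ × V2 => wgt s θ q.1 q.2) := by
  unfold wgt; fun_prop

lemma wgt_sq (s θ τ : ℝ) (ξ : V2) :
    wgt s θ τ ξ ^ 2 = (1 + ‖ξ‖ ^ 2) ^ s * (1 + |(|τ| - ‖ξ‖)|) ^ (2 * θ) := by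
  unfold wgt
  have h : ∀ x y : ℝ, 0 ≤ x → (x ^ y) ^ 2 = x ^ (2 * y) := by
    intro x y hx
    rw [← Real.rpow_natCast, ← Real.rpow_mul hx]
    congr 1
    push_cast
    ring
  rw [mul_pow, h _ _ (by positivity), h _ _ (by positivity)]
  congr 2
  ring

lemma split_sc {s x y X : ℝ} (hs : 0 ≤ s) (hs' : s ≤ 1) (hx : 0 < x) (hy : 0 < y) (hX : 0 ≤ X)
    (h : X ≤ 2 * (x + y)) : X ^ s / (x ^ s * y ^ s) ≤ 2 * (x ^ (-s) + y ^ (-s)) := by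
  have h1 : X ^ s ≤ 2 * (x ^ s + y ^ s) := by
    calc X ^ s ≤ (2 * (x + y)) ^ s := Real.rpow_le_rpow hX h hs
      _ = 2 ^ s * (x + y) ^ s := Real.mul_rpow (by norm_num) (by positivity)
      _ ≤ 2 * (x ^ s + y ^ s) := by
        apply mul_le_mul _ (Real.rpow_add_le_add_rpow hx.le hy.le hs hs') (by positivity) (by norm_num)
        calc (2:ℝ) ^ s ≤ 2 ^ (1:ℝ) := Real.rpow_le_rpow_of_exponent_le (by norm_num) hs'
          _ = 2 := by norm_num
  have hxs : 0 < x ^ s := by positivity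
  have hys : 0 < y ^ s := by positivity
  rw [Real.rpow_neg hx.le, Real.rpow_neg hy.le, div_le_iff₀ (by positivity)]
  refine h1.trans (le_of_eq ?_)
  field_simp
  ring

lemma sq_bd {s ρ : ℝ} (hs : 0 ≤ s) (hρ : 0 < ρ) : (1 + ρ ^ 2) ^ (-s) ≤ ρ ^ ((1 - 2 * s) - 1) := by
  have : ρ ^ ((1 - 2 * s) - 1) = (ρ ^ 2) ^ (-s) := by
    rw [← Real.rpow_natCast, ← Real.rpow_mul hρ.le]; congr 1; push_cast; ring
  rw [this]
  exact Real.rpow_le_rpow_of_nonpos (by positivity) (by linarith) (by linarith)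

def ker (s σ θ : ℝ) (q p : ℝ × V2) : ℝ :=
  wgt s σ q.1 q.2 * (|crs p.2 (q - p).2| / (‖p.2‖ * ‖(q - p).2‖)) /
    (wgt s θ p.1 p.2 * wgt s θ (q - p).1 (q - p).2)

lemma crs_meas (q : ℝ × V2) : Measurable (fun p : ℝ × V2 => crs p.2 (q - p).2) := by
  apply Continuous.measurable
  unfold crs
  fun_prop

lemma ker_meas (s σ θ : ℝ) (q : ℝ × V2) : Measurable (ker s σ θ q) := by
  unfold ker
  have h1 := crs_meas q
  have h2 := wgt_meas s θ
  have h3 : Measurable (fun p : ℝ × V2 => wgt s θ (q - p).1 (q - p).2) :=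
    h2.comp (measurable_const.sub measurable_id)
  have h4 : Measurable (fun p : ℝ × V2 => |crs p.2 (q - p).2|) := by
    simpa using h1.norm
  have h5 : Measurable (fun p : ℝ × V2 => ‖p.2‖ * ‖(q - p).2‖) := by fun_prop
  exact (measurable_const.mul (h4.div h5)).div (h2.mul h3)

lemma ker_bd {s σ θ : ℝ} (hs : 0 ≤ s) (hs' : s ≤ 1) (hσ : 2 * σ ≤ -(1 - 2 * s)) (q p : ℝ × V2) :
    ker s σ θ q p ^ 2 ≤ 2 * (bwt (1 - 2 * s) (q.2 0) (q.2 1) (projV p.2) *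
      (1 + |(|q.1| - √(q.2 0 ^ 2 + q.2 1 ^ 2))|) ^ (-(1 - 2 * s)) *
      ((1 + |(|p.1| - bn1 (projV p.2))|) ^ (-(2 * θ)) *
        (1 + |(|q.1 - p.1| - bn2 (q.2 0) (q.2 1) (projV p.2))|) ^ (-(2 * θ)))) := by
  have e1 : bn1 (projV p.2) = ‖p.2‖ := by rw [normV]; rfl
  have e2 : bn2 (q.2 0) (q.2 1) (projV p.2) = ‖(q - p).2‖ := by rw [normV]; rfl
  have e3 : bcr (q.2 0) (q.2 1) (projV p.2) = crs p.2 (q - p).2 := rfl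
  have e4 : bsn (q.2 0) (q.2 1) (projV p.2) = |crs p.2 (q - p).2| / (‖p.2‖ * ‖(q - p).2‖) := by
    unfold bsn; rw [e1, e2, e3]
  rw [← normV]
  unfold bwt
  rw [e4, e1, e2]
  unfold ker
  set S := |crs p.2 (q - p).2| / (‖p.2‖ * ‖(q - p).2‖) with hS
  by_cases hp : ‖p.2‖ = 0
  · have : S = 0 := by rw [hS, hp]; simp
    rw [this]; simp
  by_cases hr : ‖(q - p).2‖ = 0
  · have : S = 0 := by rw [hS, hr]; simp
    rw [this]; simp
  have hp' : 0 < ‖p.2‖ := lt_of_le_of_ne (norm_nonneg _) (Ne.symm hp)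
  have hr' : 0 < ‖(q - p).2‖ := lt_of_le_of_ne (norm_nonneg _) (Ne.symm hr)
  rw [div_pow, mul_pow, mul_pow, wgt_sq, wgt_sq, wgt_sq]
  have tri : ‖q.2‖ ≤ ‖p.2‖ + ‖(q - p).2‖ := by
    have : q.2 = p.2 + (q - p).2 := by simp
    calc ‖q.2‖ = ‖p.2 + (q - p).2‖ := by rw [← this]
      _ ≤ _ := norm_add_le _ _
  have e5 : (q - p).1 = q.1 - p.1 := rfl
  rw [e5]
  have hR0 : 0 ≤ ‖q.2‖ := norm_nonneg _
  generalize ‖q.2‖ = R at *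
  have hR : 0 ≤ 1 + R ^ 2 := by positivity
  generalize ‖p.2‖ = ρ at *
  generalize ‖(q - p).2‖ = r at *
  clear_value S
  have hsp := split_sc hs hs' (x := 1 + ρ ^ 2) (y := 1 + r ^ 2) (by positivity) (by positivity) hR
    (by nlinarith [sq_nonneg (ρ - r)])
  have b1 := sq_bd hs hp'
  have b2 := sq_bd hs hr'
  have hw : (1 + |(|q.1| - R)|) ^ (2 * σ) ≤ (1 + |(|q.1| - R)|) ^ (-(1 - 2 * s)) :=
    Real.rpow_le_rpow_of_exponent_le (by linarith [abs_nonneg (|q.1| - R)]) hσ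
  rw [Real.rpow_neg (by positivity) (2 * θ), Real.rpow_neg (by positivity) (2 * θ)]
  have hT : (1 + R ^ 2) ^ s / ((1 + ρ ^ 2) ^ s * (1 + r ^ 2) ^ s) ≤
      2 * (ρ ^ ((1 - 2 * s) - 1) + r ^ ((1 - 2 * s) - 1)) := by linarith
  have hpos1 : 0 < (1 + |(|p.1| - ρ)|) ^ (2 * θ) := by positivity
  have hpos2 : 0 < (1 + |(|q.1 - p.1| - r)|) ^ (2 * θ) := by positivity
  have hpos3 : 0 < (1 + ρ ^ 2) ^ s := by positivity
  have hpos4 : 0 < (1 + r ^ 2) ^ s := by positivity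
  have hTW := mul_le_mul hT hw (by positivity) (by positivity)
  generalize (1 + |(|p.1| - ρ)|) ^ (2 * θ) = w1 at *
  generalize (1 + |(|q.1 - p.1| - r)|) ^ (2 * θ) = w2 at *
  have hfin := mul_le_mul_of_nonneg_right hTW (show 0 ≤ S ^ 2 * (w1⁻¹ * w2⁻¹) by positivity)
  refine le_trans (le_of_eq ?_) (hfin.trans (le_of_eq ?_))
  · field_simp
  · ring

lemma key_int {s σ θ : ℝ} (hs : 1 / 4 < s) (hs' : s ≤ 1 / 2) (hσ : 2 * σ ≤ -(1 - 2 * s))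
    (hθ : 0 ≤ θ) (q : ℝ × V2) :
    ∫⁻ p : ℝ × V2, ENNReal.ofReal (ker s σ θ q p) ^ 2 ≤
      2 * (C1 (2 * θ) * (4 * Kc (1 - 2 * s) (2 * θ - (1 - 2 * s)))) := by
  rw [Measure.volume_eq_prod, lintegral_prod_symm']
  swap
  · exact (ENNReal.measurable_ofReal.comp (ker_meas s σ θ q)).pow_const 2
  have hk := key_coord (a := 1 - 2 * s) (P := 2 * θ) (by linarith) (by linarith) (by linarith)
    q.1 (q.2 0) (q.2 1)
  rw [← projV_mp.lintegral_comp_emb projV_emb] at hk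
  refine le_trans ?_ (mul_le_mul' le_rfl hk)
  rw [← lintegral_const_mul' _ _ (by norm_num)]
  apply lintegral_mono
  intro ξ
  beta_reduce
  rw [← lintegral_const_mul' _ _ (by norm_num)]
  apply lintegral_mono
  intro t
  beta_reduce
  have hk0 : 0 ≤ ker s σ θ q (t, ξ) := by
    unfold ker
    have := wgt_pos s σ q.1 q.2
    have := wgt_pos s θ t ξ
    have := wgt_pos s θ (q - (t, ξ)).1 (q - (t, ξ)).2
    positivity
  rw [← ENNReal.ofReal_pow hk0]
  have h2 : (2 : ℝ≥0∞) = ENNReal.ofReal 2 := by norm_num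
  have h3 := ENNReal.ofReal_le_ofReal
    (ker_bd (θ := θ) (by linarith) (by linarith) hσ q (t, ξ))
  rw [ENNReal.ofReal_mul (by norm_num), ← h2] at h3
  exact h3

/-- squared gradient density -/
def dens (s θ : ℝ) (φ : ℝ × V2 → ℂ) (p : ℝ × V2) : ℝ≥0∞ :=
  ENNReal.ofReal (wgt s θ p.1 p.2 * ‖p.2‖) * ‖ftST φ p.1 p.2‖ₑ

lemma dens_meas (s θ : ℝ) (φ : SchwartzMap (ℝ × V2) ℂ) : Measurable (dens s θ φ) := by
  unfold dens
  have h1 := wgt_meas s θ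
  have h2 : Measurable (fun p : ℝ × V2 => ‖ftST φ p.1 p.2‖ₑ) := (ftST_cont φ).measurable.enorm
  have h3 : Measurable (fun p : ℝ × V2 => wgt s θ p.1 p.2 * ‖p.2‖) := h1.mul (by fun_prop)
  exact (ENNReal.measurable_ofReal.comp h3).mul h2

lemma HN_sq (s θ : ℝ) (u : ℝ × V2 → ℂ) : HN s θ u ^ (2 : ℕ) =
    ∫⁻ q : ℝ × V2, (ENNReal.ofReal (wgt s θ q.1 q.2) * ‖ftST u q.1 q.2‖ₑ) ^ (2 : ℕ) := by
  unfold HN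
  rw [← ENNReal.rpow_natCast, ← ENNReal.rpow_mul]
  norm_num
  rfl

lemma gradHN_eq (s θ : ℝ) (φ : SchwartzMap (ℝ × V2) ℂ) :
    gradHN s θ φ = (∫⁻ p, dens s θ φ p ^ 2) ^ ((1:ℝ)/2) := by
  unfold gradHN
  congr 1
  rw [HN_sq, HN_sq, ← lintegral_add_left]
  · apply lintegral_congr
    intro p
    rw [ftST_pdx, ftST_pdx]
    unfold dens
    simp only [enorm_mul]
    have hI : ‖Complex.I‖ₑ = 1 := by rw [← ofReal_norm]; simp
    have hx : ∀ x : ℝ, ‖(x : ℂ)‖ₑ = ENNReal.ofReal |x| := by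
      intro x; rw [← ofReal_norm, Complex.norm_real, Real.norm_eq_abs]
    rw [hI, hx, hx, one_mul, one_mul, ENNReal.ofReal_mul (wgt_pos _ _ _ _).le]
    simp only [mul_pow]
    rw [← ENNReal.ofReal_pow (abs_nonneg _), ← ENNReal.ofReal_pow (abs_nonneg _),
      ← ENNReal.ofReal_pow (norm_nonneg _)]
    have hn : ‖p.2‖ ^ 2 = |p.2 0| ^ 2 + |p.2 1| ^ 2 := by
      rw [normV, Real.sq_sqrt (by positivity), sq_abs, sq_abs]
    rw [hn, ENNReal.ofReal_add (by positivity) (by positivity)]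
    ring
  · have h1 := wgt_meas s θ
    have h2 : Measurable (fun p : ℝ × V2 => ‖ftST (pdx 0 φ) p.1 p.2‖ₑ) := by
      rw [← pdS_apply]; exact (ftST_cont _).measurable.enorm
    exact ((ENNReal.measurable_ofReal.comp h1).mul h2).pow_const 2

lemma pt_bd (s σ θ : ℝ) (φ ψ : SchwartzMap (ℝ × V2) ℂ) (q : ℝ × V2) :
    ENNReal.ofReal (wgt s σ q.1 q.2) * ‖ftST (Q12 φ ψ) q.1 q.2‖ₑ ≤
      ∫⁻ p, ENNReal.ofReal (ker s σ θ q p) * (dens s θ φ p * dens s θ ψ (q - p)) := by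
  refine (mul_le_mul' le_rfl (ftST_Q12_le φ ψ q)).trans ?_
  rw [← lintegral_const_mul' _ _ ENNReal.ofReal_ne_top]
  apply lintegral_mono
  intro p
  beta_reduce
  unfold dens
  have w0 := wgt_pos s σ q.1 q.2
  have w1 := wgt_pos s θ p.1 p.2
  have w2 := wgt_pos s θ (q - p).1 (q - p).2
  have hk0 : 0 ≤ ker s σ θ q p := by unfold ker; positivity
  have hre : ∀ a b c d e : ℝ≥0∞, a * (b * c * (d * e)) = a * b * d * (c * e) := by
    intros; ring
  rw [hre, ← mul_assoc, ← ENNReal.ofReal_mul w0.le, ← ENNReal.ofReal_mul hk0,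
    ← ENNReal.ofReal_mul (by positivity)]
  apply mul_le_mul' _ le_rfl
  apply ENNReal.ofReal_le_ofReal
  apply le_of_eq
  unfold ker
  by_cases hp : p.2 = 0
  · simp [crs, hp]
  by_cases hr : (q - p).2 = 0
  · simp [crs, hr]
  have hp' : ‖p.2‖ ≠ 0 := norm_ne_zero_iff.2 hp
  have hr' : ‖(q - p).2‖ ≠ 0 := norm_ne_zero_iff.2 hr
  field_simp

lemma cs_sq {α : Type*} [MeasurableSpace α] (μ : Measure α) {f g : α → ℝ≥0∞}
    (hf : Measurable f) (hg : Measurable g) :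
    (∫⁻ x, f x * g x ∂μ) ^ 2 ≤ (∫⁻ x, f x ^ 2 ∂μ) * ∫⁻ x, g x ^ 2 ∂μ := by
  have h := ENNReal.lintegral_mul_le_Lp_mul_Lq μ Real.HolderConjugate.two_two
    hf.aemeasurable hg.aemeasurable
  have h2 := pow_le_pow_left' h 2
  refine h2.trans (le_of_eq ?_)
  rw [mul_pow, ← ENNReal.rpow_natCast, ← ENNReal.rpow_natCast, ← ENNReal.rpow_mul,
    ← ENNReal.rpow_mul]
  norm_num

lemma main_sq {s σ θ : ℝ} (hs : 1 / 4 < s) (hs' : s ≤ 1 / 2) (hσ : 2 * σ ≤ -(1 - 2 * s))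
    (hθ : 0 ≤ θ) (φ ψ : SchwartzMap (ℝ × V2) ℂ) :
    HN s σ (Q12 φ ψ) ^ (2 : ℕ) ≤
      2 * (C1 (2 * θ) * (4 * Kc (1 - 2 * s) (2 * θ - (1 - 2 * s)))) *
      ((∫⁻ p, dens s θ φ p ^ 2) * ∫⁻ p, dens s θ ψ p ^ 2) := by
  have := haarI
  rw [HN_sq]
  set K := 2 * (C1 (2 * θ) * (4 * Kc (1 - 2 * s) (2 * θ - (1 - 2 * s))))
  have hφ := dens_meas s θ φ
  have hψ := dens_meas s θ ψ
  calc _ ≤ ∫⁻ q : ℝ × V2, K * ∫⁻ p, (dens s θ φ p * dens s θ ψ (q - p)) ^ 2 := by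
        apply lintegral_mono
        intro q
        beta_reduce
        refine (pow_le_pow_left' (pt_bd s σ θ φ ψ q) 2).trans ?_
        refine (cs_sq volume (ENNReal.measurable_ofReal.comp (ker_meas s σ θ q)) ?_).trans ?_
        · exact hφ.mul (hψ.comp (measurable_const.sub measurable_id))
        · exact mul_le_mul' (key_int hs hs' hσ hθ q) le_rfl
    _ = K * ∫⁻ q : ℝ × V2, ∫⁻ p, (dens s θ φ p * dens s θ ψ (q - p)) ^ 2 := by
        rw [lintegral_const_mul]
        apply Measurable.lintegral_prod_right
        exact ((hφ.comp measurable_snd).mul (hψ.comp (measurable_fst.sub measurable_snd))).pow_const 2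
    _ = K * ∫⁻ p : ℝ × V2, ∫⁻ q, (dens s θ φ p * dens s θ ψ (q - p)) ^ 2 := by
        rw [lintegral_lintegral_swap]
        exact (((hφ.comp measurable_snd).mul
          (hψ.comp (measurable_fst.sub measurable_snd))).pow_const 2).aemeasurable
    _ = _ := by
        congr 1
        have : ∀ p : ℝ × V2, ∫⁻ q, (dens s θ φ p * dens s θ ψ (q - p)) ^ 2 =
            dens s θ φ p ^ 2 * ∫⁻ q, dens s θ ψ q ^ 2 := by
          intro p
          simp_rw [mul_pow]
          rw [lintegral_const_mul]
          · congr 1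
            exact lintegral_sub_right_eq_self (fun q => dens s θ ψ q ^ 2) p
          · exact (hψ.comp (measurable_id.sub_const p)).pow_const 2
        simp_rw [this]
        rw [lintegral_mul_const]
        exact hφ.pow_const 2

theorem nullform_Q12_estimate (s ε θ : ℝ)
    (hs1 : 1 / 4 < s) (hs2 : s < 1 / 2)
    (hε1 : 0 ≤ ε) (hε2 : ε < min (2 * s - 1 / 2) (1 / 2))
    (hθ1 : 3 / 4 - ε / 2 < θ) (hθ2 : θ ≤ s + 1 / 2 - ε) (hθ3 : θ < 1 - ε) :
    ∃ C : ℝ, 0 < C ∧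
      ∀ φ ψ : SchwartzMap (ℝ × V2) ℂ,
        HN s (θ - 1 + ε) (Q12 ⇑φ ⇑ψ) ≤
          ENNReal.ofReal C * (gradHN s θ ⇑φ * gradHN s θ ⇑ψ) := by
  have hε3 : ε < 2 * s - 1 / 2 := lt_of_lt_of_le hε2 (min_le_left _ _)
  set K : ℝ≥0∞ := 2 * (C1 (2 * θ) * (4 * Kc (1 - 2 * s) (2 * θ - (1 - 2 * s)))) with hK
  have hKtop : K ≠ ⊤ := by
    have h1 := C1_ne_top (P := 2 * θ) (by linarith)
    have h2 := Kc_ne_top (1 - 2 * s) (p := 2 * θ - (1 - 2 * s)) (by linarith)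
    exact ENNReal.mul_ne_top (by norm_num)
      (ENNReal.mul_ne_top h1 (ENNReal.mul_ne_top (by norm_num) h2))
  have hK2 : K ^ ((1:ℝ)/2) ≠ ⊤ := ENNReal.rpow_ne_top_of_nonneg (by norm_num) hKtop
  refine ⟨(K ^ ((1:ℝ)/2)).toReal + 1, by positivity, fun φ ψ => ?_⟩
  have hC : K ^ ((1:ℝ)/2) ≤ ENNReal.ofReal ((K ^ ((1:ℝ)/2)).toReal + 1) := by
    rw [ENNReal.le_ofReal_iff_toReal_le hK2 (by positivity)]
    linarith
  refine le_trans ?_ (mul_le_mul' hC le_rfl)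
  rw [gradHN_eq, gradHN_eq, ← ENNReal.mul_rpow_of_nonneg _ _ (by norm_num),
    ← ENNReal.mul_rpow_of_nonneg _ _ (by norm_num)]
  have hm := main_sq (σ := θ - 1 + ε) (θ := θ) hs1 hs2.le (by linarith) (by linarith) φ ψ
  have h := ENNReal.rpow_le_rpow hm (show (0:ℝ) ≤ 1 / 2 by norm_num)
  refine le_trans (le_of_eq ?_) h
  rw [← ENNReal.rpow_natCast, ← ENNReal.rpow_mul]
  norm_num
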